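/- Consider any σ_* ∈ S_*(1/(5Q³)) and let R > 0. Suppose σ, σ̃ ∈ S_*(σ_*, R/√n). Then there exists a coupling (σ_t, σ̃_t)_{t≥0} of two product replacement chains with initial states (σ, σ̃) such that for any given β > 0 and all large enough n, Pr_{σ,σ̃}(τ > β·n) ≤ 32·Q²·R/√β, where τ := min{t ≥ 0 : n^{σ_*}_{a,b}(σ_t) = n^{σ_*}_{a,b}(σ̃_t) for all a, b ∈ G}. -/

import Mathlib

open scoped BigOperators
open Filter

attribute [local instance] Classical.propDecidable

noncomputable section

namespace PR

variable (G : Type) [Group G] [Fintype G]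

/-- A configuration: an `n`-tuple of elements of `G`. -/
abbrev Config (n : ℕ) := Fin n → G

/-- The set of generating `n`-tuples. -/
def gens (n : ℕ) : Set (Config G n) :=
  {σ | Subgroup.closure (Set.range σ) = ⊤}

/-- A move of the product replacement chain: an ordered pair of distinct indices
together with a sign (`true` = multiply, `false` = multiply by inverse). -/
abbrev Move (n : ℕ) := {p : Fin n × Fin n // p.1 ≠ p.2} × Bool

/-- Applying a move: replace `σ i` by `σ i * (σ j)^{±1}`. -/
def applyMove {n : ℕ} (σ : Config G n) (m : Move n) : Config G n :=
  Function.update σ m.1.1.1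
    (σ m.1.1.1 * (if m.2 then σ m.1.1.2 else (σ m.1.1.2)⁻¹))

/-- One-step transition probability of the product replacement chain. -/
def step {n : ℕ} (σ σ' : Config G n) : ℝ :=
  ((Finset.univ.filter (fun m : Move n => applyMove G σ m = σ')).card : ℝ) /
    (Fintype.card (Move n) : ℝ)

/-- The law of `σ_t` for the chain started at `σ₀`. -/
def law {n : ℕ} (σ₀ : Config G n) : ℕ → Config G n → ℝ
  | 0 => fun σ' => if σ' = σ₀ then 1 else 0
  | (t + 1) => fun σ' => ∑ τ : Config G n, law σ₀ t τ * step G τ σ'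

/-- Probability that `σ_t ∈ E` for the chain started at `σ₀`. -/
def prob {n : ℕ} (σ₀ : Config G n) (t : ℕ) (E : Set (Config G n)) : ℝ :=
  ∑ τ ∈ Finset.univ.filter (fun τ => τ ∈ E), law G σ₀ t τ

/-- Probability of a trajectory event for the chain started at `σ₀`, over the
time horizon `{0, 1, …, T}`. -/
def pathProb {n : ℕ} (σ₀ : Config G n) (T : ℕ)
    (E : Set (Fin (T + 1) → Config G n)) : ℝ :=
  ∑ p ∈ Finset.univ.filter
      (fun p : Fin (T + 1) → Config G n => p 0 = σ₀ ∧ p ∈ E),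
    ∏ t : Fin T, step G (p t.castSucc) (p t.succ)

/-- `n_a(σ)`: the number of sites holding the group element `a`. -/
def nCount {n : ℕ} (σ : Config G n) (a : G) : ℕ :=
  (Finset.univ.filter (fun i => σ i = a)).card

/-- `n^H_non(σ)`: the number of sites whose element lies outside `H`. -/
def nNon {n : ℕ} (H : Subgroup G) (σ : Config G n) : ℕ :=
  (Finset.univ.filter (fun i => σ i ∉ H)).card

/-- `n^{id}_non(σ)`: the number of sites not holding the identity. -/
def nNonId {n : ℕ} (σ : Config G n) : ℕ :=
  (Finset.univ.filter (fun i => σ i ≠ 1)).card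

/-- `S_non(c)`. -/
def SNon (n : ℕ) (c : ℝ) : Set (Config G n) :=
  {σ | σ ∈ gens G n ∧
    ∀ H : Subgroup G, H ≠ ⊤ → c * n ≤ (nNon G H σ : ℝ)}

/-- The `δ`-typical set `S_*(δ)`. -/
def SAst (n : ℕ) (δ : ℝ) : Set (Config G n) :=
  {σ | σ ∈ gens G n ∧
    Real.sqrt (∑ a : G, ((nCount G σ a : ℝ) / n - 1 / (Fintype.card G : ℝ)) ^ 2) ≤ δ}

/-- `n^{σ₀}_{a,b}(σ)`. -/
def nab {n : ℕ} (σ₀ σ : Config G n) (a b : G) : ℕ :=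
  (Finset.univ.filter (fun i => σ₀ i = a ∧ σ i = b)).card

/-- `S_*(σ₀, r)`. -/
def SAstM {n : ℕ} (σ₀ : Config G n) (r : ℝ) : Set (Config G n) :=
  {σ | σ ∈ gens G n ∧
    ∀ a : G, Real.sqrt (∑ b : G,
      ((nab G σ₀ σ a b : ℝ) / (nCount G σ₀ a : ℝ) - 1 / (Fintype.card G : ℝ)) ^ 2) ≤ r}

/-- The uniform stationary distribution `π` on the set of generating tuples. -/
def statDist (n : ℕ) : Config G n → ℝ := fun σ =>
  if σ ∈ gens G n then
    1 / ((Finset.univ.filter (fun τ : Config G n => τ ∈ gens G n)).card : ℝ)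
  else 0

/-- Total-variation distance between two (finitely supported) signed weights,
as the supremum over finite sets `A` of `|p(A) - q(A)|`. -/
def tvDist {α : Type*} (p q : α → ℝ) : ℝ :=
  sSup {x : ℝ | ∃ A : Finset α, x = |∑ a ∈ A, p a - ∑ a ∈ A, q a|}

/-- `d_σ(t) = max_{A ⊆ S} |P_σ(σ_t ∈ A) - π(A)|`. -/
def dTV {n : ℕ} (σ : Config G n) (t : ℕ) : ℝ :=
  sSup {x : ℝ | ∃ A : Finset (Config G n), ↑A ⊆ gens G n ∧
    x = |∑ τ ∈ A, law G σ t τ - ∑ τ ∈ A, statDist G n τ|}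

/-- `max_{σ ∈ S} d_σ(t)`. -/
def dMax (n : ℕ) (t : ℕ) : ℝ :=
  sSup {x : ℝ | ∃ σ ∈ gens G n, x = dTV G σ t}

end PR

namespace PR

variable (G : Type) [Group G] [Fintype G]

/-- A (Markovian) coupling kernel for two copies of the product replacement chain:
a transition kernel on pairs of configurations, both of whose marginals are the
one-step transition probabilities of the product replacement chain. -/
def IsCouplingKernel {n : ℕ}
    (K : Config G n × Config G n → Config G n × Config G n → ℝ) : Prop :=
  (∀ p q, 0 ≤ K p q) ∧
  (∀ p s', (∑ st' : Config G n, K p (s', st')) = step G p.1 s') ∧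
  (∀ p st', (∑ s' : Config G n, K p (s', st')) = step G p.2 st')

/-- Probability of a trajectory event for the coupled chain driven by the kernel `K`,
started at the pair `start`, over the time horizon `{0, 1, …, T}`. -/
def jointPathProb {n : ℕ}
    (K : Config G n × Config G n → Config G n × Config G n → ℝ)
    (start : Config G n × Config G n) (T : ℕ)
    (E : Set (Fin (T + 1) → Config G n × Config G n)) : ℝ :=
  ∑ p ∈ Finset.univ.filter
      (fun p : Fin (T + 1) → Config G n × Config G n => p 0 = start ∧ p ∈ E),
    ∏ t : Fin T, K (p t.castSucc) (p t.succ)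

end PR

namespace PR

set_option linter.unusedSectionVars false

section Matching

variable {ι ρ Y : Type*} [Fintype ι]

/-- The number of places where two functions differ. -/
def mism (f g : ι → Y) : ℕ := (Finset.univ.filter (fun i => f i ≠ g i)).card

/-- The least number of mismatches between `f` and a rearrangement of `g` along the
fibres of `r`. -/
def rowDist (r : ι → ρ) (f g : ι → Y) : ℕ :=
  sInf {k | ∃ π : Equiv.Perm ι, (∀ i, r (π i) = r i) ∧ mism f (g ∘ π) = k}

theorem rowDist_set_nonempty (r : ι → ρ) (f g : ι → Y) :
    {k | ∃ π : Equiv.Perm ι, (∀ i, r (π i) = r i) ∧ mism f (g ∘ π) = k}.Nonempty :=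
  ⟨_, 1, fun _ => rfl, rfl⟩

theorem exists_perm_mism_eq_rowDist (r : ι → ρ) (f g : ι → Y) :
    ∃ π : Equiv.Perm ι, (∀ i, r (π i) = r i) ∧ mism f (g ∘ π) = rowDist r f g :=
  Nat.sInf_mem (rowDist_set_nonempty r f g)

theorem rowDist_le (r : ι → ρ) (f g : ι → Y) (π : Equiv.Perm ι) (hπ : ∀ i, r (π i) = r i) :
    rowDist r f g ≤ mism f (g ∘ π) :=
  Nat.sInf_le ⟨π, hπ, rfl⟩

/-- Number of points in a cell. -/
def cell (r : ι → ρ) (f : ι → Y) (a : ρ) (b : Y) : ℕ :=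
  (Finset.univ.filter (fun i => r i = a ∧ f i = b)).card

theorem cell_comp_perm (r : ι → ρ) (g : ι → Y) (π : Equiv.Perm ι) (hπ : ∀ i, r (π i) = r i)
    (a : ρ) (b : Y) : cell r (g ∘ π) a b = cell r g a b := by
  unfold cell
  refine Finset.card_bij (fun i _ => π i) ?_ ?_ ?_
  · intro i hi
    simpa [hπ] using hi
  · intro i _ j _ h
    exact π.injective h
  · intro j hj
    refine ⟨π.symm j, ?_, by simp⟩
    have := hπ (π.symm j)
    simp at this hj ⊢
    rw [← this]; exact hj

theorem cell_eq_of_rowDist_eq_zero (r : ι → ρ) (f g : ι → Y) (h : rowDist r f g = 0)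
    (a : ρ) (b : Y) : cell r f a b = cell r g a b := by
  obtain ⟨π, hπ, he⟩ := exists_perm_mism_eq_rowDist r f g
  rw [h, mism, Finset.card_eq_zero, Finset.filter_eq_empty_iff] at he
  have : f = g ∘ π := by
    funext i
    simpa using he (Finset.mem_univ i)
  rw [this, cell_comp_perm r g π hπ]

theorem rowDist_le_sum [Fintype ρ] [Fintype Y] (r : ι → ρ) (f g : ι → Y) :
    (rowDist r f g : ℝ) ≤ ∑ a, ∑ b, |(cell r f a b : ℝ) - cell r g a b| := by
  obtain ⟨π, hπ, he⟩ := exists_perm_mism_eq_rowDist r f g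
  simp_rw [← cell_comp_perm r g π hπ]
  have hmin : ∀ κ : Equiv.Perm ι, (∀ i, r (κ i) = r i) →
      mism f (g ∘ π) ≤ mism f ((g ∘ π) ∘ κ) := fun κ hκ => by
    rw [he]
    exact rowDist_le r f g (κ.trans π) (fun i => by simp [hπ, hκ])
  rw [← he]
  generalize g ∘ π = h at hmin
  have key : ∀ a b, ((Finset.univ.filter (fun i => f i ≠ h i ∧ r i = a ∧ f i = b)).card : ℝ) ≤
      |(cell r f a b : ℝ) - cell r h a b| := by
    intro a b
    have hf : cell r f a b = (Finset.univ.filter (fun i => f i ≠ h i ∧ r i = a ∧ f i = b)).card +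
        (Finset.univ.filter (fun i => f i = h i ∧ r i = a ∧ f i = b)).card := by
      unfold cell
      rw [← Finset.card_union_of_disjoint]
      · congr 1; ext i; simp; tauto
      · rw [Finset.disjoint_filter]; tauto
    have hh : cell r h a b = (Finset.univ.filter (fun i => f i ≠ h i ∧ r i = a ∧ h i = b)).card +
        (Finset.univ.filter (fun i => f i = h i ∧ r i = a ∧ f i = b)).card := by
      unfold cell
      rw [← Finset.card_union_of_disjoint]
      · congr 1; ext i; simp; grind
      · rw [Finset.disjoint_filter]; tauto
    rcases Finset.eq_empty_or_nonempty
      (Finset.univ.filter (fun i => f i ≠ h i ∧ r i = a ∧ f i = b)) with hP | ⟨i, hi⟩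
    · rw [hP]; simp
    rcases Finset.eq_empty_or_nonempty
      (Finset.univ.filter (fun i => f i ≠ h i ∧ r i = a ∧ h i = b)) with hN | ⟨j, hj⟩
    · rw [hf, hh, hN]; simp
    exfalso
    simp only [Finset.mem_filter, Finset.mem_univ, true_and] at hi hj
    have hlt : mism f (h ∘ Equiv.swap i j) < mism f h := by
      unfold mism
      apply Finset.card_lt_card
      rw [Finset.ssubset_iff_of_subset]
      · refine ⟨i, by simpa using hi.1, ?_⟩
        simp [hi.2.2, hj.2.2]
      · intro k hk
        simp only [Finset.mem_filter, Finset.mem_univ, true_and, Function.comp] at hk ⊢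
        rcases eq_or_ne k i with rfl | hki
        · exact hi.1
        rcases eq_or_ne k j with rfl | hkj
        · exact hj.1
        rwa [Equiv.swap_apply_of_ne_of_ne hki hkj] at hk
    refine absurd (hmin (Equiv.swap i j) ?_) (not_le.2 hlt)
    intro k
    rcases eq_or_ne k i with rfl | hki
    · simp [hi.2.1, hj.2.1]
    rcases eq_or_ne k j with rfl | hkj
    · simp [hi.2.1, hj.2.1]
    rw [Equiv.swap_apply_of_ne_of_ne hki hkj]
  refine le_trans ?_ (Finset.sum_le_sum fun a _ => Finset.sum_le_sum fun b _ => key a b)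
  have : mism f h = ∑ a, ∑ b,
      (Finset.univ.filter (fun i => f i ≠ h i ∧ r i = a ∧ f i = b)).card := by
    unfold mism
    rw [← Fintype.sum_prod_type',
      Finset.card_eq_sum_card_fiberwise (f := fun i => (r i, f i)) (t := Finset.univ)
        (fun _ _ => by simp)]
    refine Finset.sum_congr rfl fun x _ => ?_
    congr 1; ext i; simp [Prod.ext_iff]
  rw [this]; push_cast; rfl

theorem exists_perm_exchanging {α : Type*} (A B : Finset α) (hd : Disjoint A B) (hc : A.card = B.card) :
    ∃ θ : Equiv.Perm α, (∀ z ∈ A, θ z ∈ B) ∧ (∀ z ∈ B, θ z ∈ A) ∧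
      ∀ z, z ∉ A → z ∉ B → θ z = z := by
  let e : A ≃ B := Finset.equivOfCardEq hc
  rw [Finset.disjoint_left] at hd
  let φ : α → α := fun z =>
    if hz : z ∈ A then e ⟨z, hz⟩ else if hz : z ∈ B then e.symm ⟨z, hz⟩ else z
  have hA : ∀ z (hz : z ∈ A), φ z = e ⟨z, hz⟩ := fun z hz => by simp [φ, hz]
  have hB : ∀ z (hz : z ∈ B), φ z = e.symm ⟨z, hz⟩ := fun z hz => by
    have : z ∉ A := fun h => hd h hz
    simp [φ, hz, this]
  have hC : ∀ z, z ∉ A → z ∉ B → φ z = z := fun z h h' => by simp [φ, h, h']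
  have hinv : Function.Involutive φ := by
    intro z
    by_cases hzA : z ∈ A
    · rw [hA z hzA, hB _ (e ⟨z, hzA⟩).2]; simp
    by_cases hzB : z ∈ B
    · rw [hB z hzB, hA _ (e.symm ⟨z, hzB⟩).2]; simp
    rw [hC z hzA hzB, hC z hzA hzB]
  refine ⟨hinv.toPerm, fun z hz => ?_, fun z hz => ?_, fun z h h' => hC z h h'⟩
  · simp [hA z hz]
  · simp [hB z hz]

end Matching

section Kernel

variable (G : Type) [Group G] [Fintype G]

/-- A function dominating one backward step off the target bounds the probability of
avoiding the target. -/
theorem jointPathProb_le {n : ℕ} {K : Config G n × Config G n → Config G n × Config G n → ℝ}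
    (hK : ∀ p q, 0 ≤ K p q) (E : Set (Config G n × Config G n))
    (F : ℕ → Config G n × Config G n → ℝ) (T : ℕ)
    (hpos : ∀ k ≤ T, ∀ p, 0 ≤ F k p) (h0 : ∀ p ∈ E, 1 ≤ F 0 p)
    (hstep : ∀ k < T, ∀ p ∈ E, ∑ q, K p q * F k q ≤ F (k + 1) p)
    (start : Config G n × Config G n) :
    jointPathProb G K start T {p | ∀ t, p t ∈ E} ≤ F T start := by
  suffices h : ∀ k ≤ T, ∀ s, jointPathProb G K s k {p | ∀ t, p t ∈ E} ≤ F k s from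
    h T le_rfl start
  intro k
  induction k with
  | zero =>
    intro _ s
    by_cases hs : s ∈ E
    · refine le_trans ?_ (h0 s hs)
      unfold jointPathProb
      simp only [Finset.univ_eq_empty, Finset.prod_empty, Finset.sum_const, nsmul_eq_mul, mul_one]
      norm_cast
      rw [Finset.card_le_one]
      intro p hp q hq
      simp only [Finset.mem_filter] at hp hq
      funext t
      rw [Fin.fin_one_eq_zero t, hp.2.1, hq.2.1]
    · refine le_trans (le_of_eq ?_) (hpos 0 (Nat.zero_le _) s)
      unfold jointPathProb
      refine Finset.sum_eq_zero fun p hp => ?_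
      simp only [Finset.mem_filter] at hp
      obtain ⟨-, rfl, hp⟩ := hp
      exact absurd (hp 0) hs
  | succ k ih =>
    intro hk s
    by_cases hs : s ∈ E
    · refine le_trans ?_ (hstep k hk s hs)
      refine le_trans (le_of_eq ?_) (Finset.sum_le_sum fun q _ =>
        mul_le_mul_of_nonneg_left (ih (by omega) q) (hK s q))
      unfold jointPathProb
      simp_rw [Finset.mul_sum, Finset.sum_filter]
      rw [Finset.sum_comm]
      rw [← (Fin.consEquiv fun _ => Config G n × Config G n).sum_comp, Fintype.sum_prod_type,
        Finset.sum_comm]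
      refine Finset.sum_congr rfl fun p _ => ?_
      rw [Finset.sum_eq_single s, Finset.sum_eq_single (p 0)]
      · simp only [Fin.consEquiv_apply, Fin.cons_zero, true_and, Set.mem_ofPred_eq,
          Fin.forall_fin_succ (n := k + 1), Fin.cons_succ, hs]
        rw [Fin.prod_univ_succ]
        simp
      · intro q _ hq
        simp [hq.symm]
      · simp
      · intro q _ hq
        simp [Fin.consEquiv_apply, hq]
      · simp
    · refine le_trans (le_of_eq ?_) (hpos _ hk s)
      unfold jointPathProb
      refine Finset.sum_eq_zero fun p hp => ?_
      simp only [Finset.mem_filter] at hp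
      obtain ⟨-, rfl, hp⟩ := hp
      exact absurd (hp 0) hs

/-- The coupling kernel in which the second chain uses the move `Θ p m` when the first
chain uses the uniformly random move `m`. -/
def permKernel {n : ℕ} (Θ : Config G n × Config G n → Equiv.Perm (Move n))
    (p q : Config G n × Config G n) : ℝ :=
  ((Finset.univ.filter (fun m : Move n =>
    applyMove G p.1 m = q.1 ∧ applyMove G p.2 (Θ p m) = q.2)).card : ℝ) /
    (Fintype.card (Move n) : ℝ)

theorem permKernel_isCouplingKernel {n : ℕ}
    (Θ : Config G n × Config G n → Equiv.Perm (Move n)) :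
    IsCouplingKernel G (permKernel G Θ) := by
  refine ⟨fun p q => by unfold permKernel; positivity, fun p s => ?_, fun p s => ?_⟩
  · unfold permKernel step
    rw [← Finset.sum_div, ← Nat.cast_sum]
    congr 2
    rw [Finset.card_eq_sum_card_fiberwise (f := fun m => applyMove G p.2 (Θ p m))
      (t := Finset.univ) (fun _ _ => by simp)]
    simp [Finset.filter_filter]
  · unfold permKernel step
    rw [← Finset.sum_div, ← Nat.cast_sum]
    congr 2
    rw [← Finset.card_map (Θ p).symm.toEmbedding,
      Finset.card_eq_sum_card_fiberwise (f := fun m => applyMove G p.1 m)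
      (t := Finset.univ) (fun _ _ => by simp)]
    refine Finset.sum_congr rfl fun s' _ => ?_
    congr 1
    ext m
    simp [Finset.mem_map_equiv, and_comm]

theorem sum_permKernel_mul {n : ℕ} (Θ : Config G n × Config G n → Equiv.Perm (Move n))
    (p : Config G n × Config G n) (F : Config G n × Config G n → ℝ) :
    ∑ q, permKernel G Θ p q * F q =
      (∑ m, F (applyMove G p.1 m, applyMove G p.2 (Θ p m))) / (Fintype.card (Move n) : ℝ) := by
  unfold permKernel
  simp_rw [div_mul_eq_mul_div]
  rw [← Finset.sum_div]
  congr 1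
  simp_rw [Finset.card_filter, Nat.cast_sum, Finset.sum_mul]
  rw [Finset.sum_comm]
  refine Finset.sum_congr rfl fun m _ => ?_
  rw [Finset.sum_eq_single (applyMove G p.1 m, applyMove G p.2 (Θ p m))]
  · simp
  · rintro ⟨a, b⟩ _ h
    have : ¬ (applyMove G p.1 m = a ∧ applyMove G p.2 (Θ p m) = b) := by
      rintro ⟨rfl, rfl⟩; exact h rfl
    simp [this]
  · simp

/-- Moves listed by the site they update. -/
def moveEquiv (n : ℕ) : (Σ i : Fin n, {j : Fin n // i ≠ j} × Bool) ≃ Move n where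
  toFun x := (⟨(x.1, x.2.1.1), x.2.1.2⟩, x.2.2)
  invFun m := ⟨m.1.1.1, ⟨m.1.1.2, m.1.2⟩, m.2⟩
  left_inv _ := rfl
  right_inv _ := rfl

theorem card_partner {n : ℕ} (i : Fin n) :
    Fintype.card ({j : Fin n // i ≠ j} × Bool) = 2 * (n - 1) := by
  have : Fintype.card {j : Fin n // i ≠ j} = n - 1 := by
    have := Fintype.card_subtype_compl (fun j : Fin n => i = j)
    simp at this ⊢
  rw [Fintype.card_prod, this, Fintype.card_bool, mul_comm]

theorem card_move (n : ℕ) : Fintype.card (Move n) = n * (2 * (n - 1)) := by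
  rw [← Fintype.card_congr (moveEquiv n), Fintype.card_sigma]
  simp_rw [card_partner]
  simp

/-- The element by which a move multiplies. -/
def factor {ι : Type*} (σ : ι → G) (j : ι) (s : Bool) : G := if s then σ j else (σ j)⁻¹

end Kernel

section Spread

variable (G : Type) [Group G] [Fintype G]

/-- Centred number of sites holding `c`. -/
def excess {n : ℕ} (σ : Config G n) (c : G) : ℝ :=
  (nCount G σ c : ℝ) - n / Fintype.card G

/-- Squared distance of the counts from the uniform ones. -/
def spread {n : ℕ} (σ : Config G n) : ℝ := ∑ c, excess G σ c ^ 2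

theorem spread_nonneg {n : ℕ} (σ : Config G n) : 0 ≤ spread G σ :=
  Finset.sum_nonneg fun _ _ => sq_nonneg _

theorem nCount_le {n : ℕ} (σ : Config G n) (c : G) : nCount G σ c ≤ n := by
  simpa [nCount] using Finset.card_le_univ (Finset.univ.filter (fun i => σ i = c))

theorem sum_comp_config {n : ℕ} (σ : Config G n) (f : G → ℝ) :
    ∑ i, f (σ i) = ∑ b, (nCount G σ b : ℝ) * f b := by
  rw [← Finset.sum_fiberwise Finset.univ σ]
  refine Finset.sum_congr rfl fun b _ => ?_
  rw [Finset.sum_congr rfl (g := fun _ => f b)]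
  · simp [nCount]
  · intro i hi
    simp at hi
    rw [hi]

theorem nCount_update {n : ℕ} (σ : Config G n) (i : Fin n) (x c : G) :
    (nCount G (Function.update σ i x) c : ℝ) =
      nCount G σ c + ((if x = c then 1 else 0) - (if σ i = c then 1 else 0)) := by
  unfold nCount
  simp_rw [Finset.card_filter]
  push_cast
  rw [← Finset.add_sum_erase _ _ (Finset.mem_univ i), ← Finset.add_sum_erase _
    (fun j => if σ j = c then (1 : ℝ) else 0) (Finset.mem_univ i)]
  rw [Finset.sum_congr rfl (g := fun j => if σ j = c then (1 : ℝ) else 0)]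
  · simp; ring
  · intro j hj
    rw [Function.update_of_ne (Finset.ne_of_mem_erase hj)]

theorem spread_update_le {n : ℕ} (σ : Config G n) (i : Fin n) (x : G) :
    spread G (Function.update σ i x) ≤
      spread G σ + 2 * (excess G σ x - excess G σ (σ i)) + 2 := by
  have h1 : ∀ c, excess G (Function.update σ i x) c ^ 2 ≤ excess G σ c ^ 2 +
      2 * ((if x = c then excess G σ c else 0) - (if σ i = c then excess G σ c else 0)) +
      ((if x = c then 1 else 0) + (if σ i = c then 1 else 0)) := by
    intro c
    unfold excess
    rw [nCount_update]
    split_ifs <;> nlinarith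
  refine (Finset.sum_le_sum fun c _ => h1 c).trans (le_of_eq ?_)
  rw [Finset.sum_add_distrib, Finset.sum_add_distrib, Finset.sum_add_distrib, ← Finset.mul_sum,
    Finset.sum_sub_distrib]
  simp [spread]
  norm_num

theorem sum_move {n : ℕ} (h : Fin n → Fin n → Bool → ℝ) :
    ∑ m : Move n, h m.1.1.1 m.1.1.2 m.2 = ∑ s, ∑ j, ((∑ i, h i j s) - h j j s) := by
  rw [Fintype.sum_prod_type, Finset.sum_comm]
  refine Finset.sum_congr rfl fun s _ => ?_
  rw [Finset.sum_sub_distrib, Finset.sum_comm, ← Fintype.sum_prod_type']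
  have h1 : ∑ x : {p : Fin n × Fin n // p.1 ≠ p.2}, h x.1.1 x.1.2 s =
      ∑ p ∈ Finset.univ.filter (fun p : Fin n × Fin n => p.1 ≠ p.2), h p.1 p.2 s := by
    rw [Finset.sum_subtype (p := fun p : Fin n × Fin n => p.1 ≠ p.2)]
    intro x; simp
  have h2 : ∑ j : Fin n, h j j s =
      ∑ p ∈ Finset.univ.filter (fun p : Fin n × Fin n => ¬ p.1 ≠ p.2), h p.1 p.2 s := by
    refine Finset.sum_bij (fun j _ => (j, j)) ?_ ?_ ?_ ?_
    · intro j _; simp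
    · intro i _ j _ hij; simpa using hij
    · rintro ⟨i, j⟩ hij
      simp at hij
      exact ⟨i, Finset.mem_univ _, by simp [hij]⟩
    · intro j _; rfl
  rw [h1, h2, ← Finset.sum_filter_add_sum_filter_not Finset.univ
    (fun p : Fin n × Fin n => p.1 ≠ p.2)]
  ring

theorem sum_excess_mul_sub_le {n : ℕ} (σ : Config G n) (g : G) :
    ∑ i, (excess G σ (σ i * g) - excess G σ (σ i)) ≤ 0 := by
  rw [sum_comp_config G σ (fun b => excess G σ (b * g) - excess G σ b)]
  have hshift : ∀ f : G → ℝ, ∑ b, f (b * g) = ∑ b, f b := fun f =>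
    _root_.Equiv.sum_comp (Equiv.mulRight g) f
  have h1 : ∀ b, (nCount G σ b : ℝ) * (excess G σ (b * g) - excess G σ b) ≤
      (n / Fintype.card G) * (excess G σ (b * g) - excess G σ b) +
      (excess G σ (b * g) ^ 2 - excess G σ b ^ 2) / 2 := by
    intro b
    have : (nCount G σ b : ℝ) = excess G σ b + n / Fintype.card G := by unfold excess; ring
    rw [this]
    nlinarith [sq_nonneg (excess G σ (b * g) - excess G σ b)]
  refine (Finset.sum_le_sum fun b _ => h1 b).trans (le_of_eq ?_)
  rw [Finset.sum_add_distrib, ← Finset.mul_sum, ← Finset.sum_div, Finset.sum_sub_distrib,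
    Finset.sum_sub_distrib, hshift, hshift (fun b => excess G σ b ^ 2)]
  simp

theorem sum_spread_applyMove_le {n : ℕ} (hn : 2 ≤ n) (σ : Config G n) :
    ∑ m : Move n, spread G (applyMove G σ m) ≤
      (Fintype.card (Move n) : ℝ) * (spread G σ + 6) := by
  have h1 : ∑ m : Move n, spread G (applyMove G σ m) ≤ ∑ m : Move n,
      (spread G σ + 2 * (excess G σ (σ m.1.1.1 * factor G σ m.1.1.2 m.2) -
        excess G σ (σ m.1.1.1)) + 2) :=
    Finset.sum_le_sum fun m _ => spread_update_le G σ _ _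
  refine h1.trans ?_
  rw [Finset.sum_add_distrib, Finset.sum_add_distrib, ← Finset.mul_sum,
    sum_move (fun i j s => excess G σ (σ i * factor G σ j s) - excess G σ (σ i))]
  have h2 : ∑ s, ∑ j, ((∑ i, (excess G σ (σ i * factor G σ j s) - excess G σ (σ i))) -
      (excess G σ (σ j * factor G σ j s) - excess G σ (σ j))) ≤
      ∑ _s : Bool, ∑ _j : Fin n, (n : ℝ) := by
    refine Finset.sum_le_sum fun s _ => Finset.sum_le_sum fun j _ => ?_
    have h3 := sum_excess_mul_sub_le G σ (factor G σ j s)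
    have h4 : (nCount G σ (σ j) : ℝ) ≤ n := by exact_mod_cast nCount_le G σ (σ j)
    have h5 : (0 : ℝ) ≤ nCount G σ (σ j * factor G σ j s) := by positivity
    have h6 : excess G σ (σ j) - excess G σ (σ j * factor G σ j s) ≤ n := by
      unfold excess; linarith
    linarith
  simp only [Finset.sum_const, Finset.card_univ, Fintype.card_bool, Fintype.card_fin,
    nsmul_eq_mul] at h2 ⊢
  rw [card_move]
  push_cast [Nat.cast_sub (show 1 ≤ n by omega)] at h2 ⊢
  have : (2 : ℝ) ≤ n := by exact_mod_cast hn
  nlinarith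

end Spread

section Site

variable (G : Type) [Group G] [Fintype G]

theorem sum_partner {n : ℕ} (i : Fin n) (h : Fin n → Bool → ℝ) :
    ∑ z : {j : Fin n // i ≠ j} × Bool, h z.1.1 z.2 = ∑ s, ((∑ j, h j s) - h i s) := by
  rw [Fintype.sum_prod_type, Finset.sum_comm]
  refine Finset.sum_congr rfl fun s _ => ?_
  rw [← Finset.sum_subtype (Finset.univ.erase i) (p := fun j => i ≠ j)
    (fun j => by simp [eq_comm]) (fun j => h j s)]
  rw [← Finset.add_sum_erase _ _ (Finset.mem_univ i)]
  ring

theorem card_partner_mem_le {n : ℕ} (i : Fin n) (U : Finset (Fin n)) :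
    ((Finset.univ.filter
      (fun z : {j : Fin n // i ≠ j} × Bool => z.1.1 ∈ U)).card : ℝ) ≤ 2 * U.card := by
  rw [Finset.card_filter]
  push_cast
  rw [sum_partner i (fun j _ => if j ∈ U then (1 : ℝ) else 0)]
  simp
  split_ifs <;> norm_num

theorem abs_card_factor_sub_le {n : ℕ} (σ : Config G n) (i : Fin n) (g : G) {δ : ℝ}
    (hσ : ∀ c, |excess G σ c| ≤ δ) :
    2 * n / Fintype.card G - 2 * δ - 2 ≤ ((Finset.univ.filter
      (fun z : {j : Fin n // i ≠ j} × Bool => factor G σ z.1.1 z.2 = g)).card : ℝ) ∧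
    ((Finset.univ.filter
      (fun z : {j : Fin n // i ≠ j} × Bool => factor G σ z.1.1 z.2 = g)).card : ℝ) ≤
      2 * n / Fintype.card G + 2 * δ := by
  rw [Finset.card_filter]
  push_cast
  rw [sum_partner i (fun j s => if factor G σ j s = g then (1 : ℝ) else 0)]
  have h1 : ∑ j, (if factor G σ j true = g then (1 : ℝ) else 0) = nCount G σ g := by
    simp [factor, nCount]
  have h2 : ∑ j, (if factor G σ j false = g then (1 : ℝ) else 0) = nCount G σ g⁻¹ := by
    simp [factor, nCount, inv_eq_iff_eq_inv]
  rw [Fintype.sum_bool, h1, h2]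
  have h3 : ∀ s, (0 : ℝ) ≤ (if factor G σ i s = g then 1 else 0) ∧
      (if factor G σ i s = g then (1 : ℝ) else 0) ≤ 1 := fun s => by
    split_ifs <;> norm_num
  have h4 := abs_le.1 (hσ g)
  have h5 := abs_le.1 (hσ g⁻¹)
  have h6 : (2 : ℝ) * n / Fintype.card G = n / Fintype.card G + n / Fintype.card G := by ring
  unfold excess at h4 h5
  rw [h6]
  constructor <;> linarith [(h3 true).1, (h3 true).2, (h3 false).1, (h3 false).2]

/-- Factors of the two chains can be matched so that a given discrepancy is almost always
removed. -/
theorem exists_perm_mism_le {n : ℕ} (σ τ : Config G n) (i : Fin n) {δ : ℝ}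
    (hσ : ∀ c, |excess G σ c| ≤ δ) (hτ : ∀ c, |excess G τ c| ≤ δ) :
    ∃ θ : Equiv.Perm ({j : Fin n // i ≠ j} × Bool),
      (mism (fun z => σ i * factor G σ z.1.1 z.2)
        ((fun z : {j : Fin n // i ≠ j} × Bool => τ i * factor G τ z.1.1 z.2) ∘ θ) : ℝ) ≤
      Fintype.card G * (4 * δ + 2) := by
  obtain ⟨θ, -, hθ⟩ := exists_perm_mism_eq_rowDist
    (fun _ : {j : Fin n // i ≠ j} × Bool => ()) (fun z => σ i * factor G σ z.1.1 z.2)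
    (fun z => τ i * factor G τ z.1.1 z.2)
  refine ⟨θ, ?_⟩
  rw [hθ]
  refine (rowDist_le_sum _ _ _).trans ?_
  rw [Fintype.sum_unique]
  have hδ : 0 ≤ δ := (abs_nonneg _).trans (hσ 1)
  refine (Finset.sum_le_card_nsmul _ _ (4 * δ + 2) fun c _ => ?_).trans (by rw [nsmul_eq_mul, Finset.card_univ])
  have hc : ∀ υ : Config G n, cell (fun _ : {j : Fin n // i ≠ j} × Bool => ())
      (fun z => υ i * factor G υ z.1.1 z.2) default c = (Finset.univ.filter
      (fun z : {j : Fin n // i ≠ j} × Bool => factor G υ z.1.1 z.2 = (υ i)⁻¹ * c)).card := by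
    intro υ
    unfold cell
    congr 1
    ext z
    simp [eq_inv_mul_iff_mul_eq]
  rw [hc, hc, abs_le]
  have h1 := abs_card_factor_sub_le G σ i ((σ i)⁻¹ * c) hσ
  have h2 := abs_card_factor_sub_le G τ i ((τ i)⁻¹ * c) hτ
  constructor <;> linarith [h1.1, h1.2, h2.1, h2.2]

/-- Equally large sets of factors avoiding the sites in `U` and sending the site `i` to `x`,
respectively `y`. -/
theorem exists_balanced_factors {n : ℕ} (σ : Config G n) (i : Fin n) (U : Finset (Fin n))
    {x y : G} (hxy : x ≠ y) {δ : ℝ} (hσ : ∀ c, |excess G σ c| ≤ δ) :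
    ∃ A B : Finset ({j : Fin n // i ≠ j} × Bool), Disjoint A B ∧ A.card = B.card ∧
      2 * n / Fintype.card G - 2 * δ - 2 - 2 * U.card ≤ (B.card : ℝ) ∧
      (∀ z ∈ A, z.1.1 ∉ U ∧ σ i * factor G σ z.1.1 z.2 = x) ∧
      (∀ z ∈ B, z.1.1 ∉ U ∧ σ i * factor G σ z.1.1 z.2 = y) := by
  let J : G → Finset ({j : Fin n // i ≠ j} × Bool) := fun x => Finset.univ.filter
    (fun z => z.1.1 ∉ U ∧ σ i * factor G σ z.1.1 z.2 = x)
  have hJ : ∀ x, 2 * n / Fintype.card G - 2 * δ - 2 - 2 * U.card ≤ ((J x).card : ℝ) := by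
    intro x
    have h1 := (abs_card_factor_sub_le G σ i ((σ i)⁻¹ * x) hσ).1
    have h2 := card_partner_mem_le i U
    have h3 : (Finset.univ.filter (fun z : {j : Fin n // i ≠ j} × Bool =>
        factor G σ z.1.1 z.2 = (σ i)⁻¹ * x)).card ≤ (J x).card +
        (Finset.univ.filter (fun z : {j : Fin n // i ≠ j} × Bool => z.1.1 ∈ U)).card := by
      refine le_trans (Finset.card_le_card ?_) (Finset.card_union_le _ _)
      intro z hz
      simp [J, eq_inv_mul_iff_mul_eq] at hz ⊢
      tauto
    have h3' : ((Finset.univ.filter (fun z : {j : Fin n // i ≠ j} × Bool =>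
        factor G σ z.1.1 z.2 = (σ i)⁻¹ * x)).card : ℝ) ≤ (J x).card +
        (Finset.univ.filter (fun z : {j : Fin n // i ≠ j} × Bool => z.1.1 ∈ U)).card := by
      exact_mod_cast h3
    linarith
  obtain ⟨A, hA, hAc⟩ := Finset.exists_subset_card_eq (min_le_left (J x).card (J y).card)
  obtain ⟨B, hB, hBc⟩ := Finset.exists_subset_card_eq (min_le_right (J x).card (J y).card)
  refine ⟨A, B, ?_, by rw [hAc, hBc], ?_, fun z hz => ?_, fun z hz => ?_⟩
  · refine Disjoint.mono hA hB ?_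
    rw [Finset.disjoint_left]
    intro z hz hz'
    simp [J] at hz hz'
    exact hxy (hz.2.symm.trans hz'.2)
  · rw [hBc]
    push_cast
    exact le_min (hJ x) (hJ y)
  · simpa [J] using hA hz
  · simpa [J] using hB hz

theorem mism_update {n : ℕ} {Y : Type*} (σ τ : Fin n → Y) (i : Fin n) (u v : Y) :
    (mism (Function.update σ i u) (Function.update τ i v) : ℤ) =
      mism σ τ + (if u = v then 0 else 1) - (if σ i = τ i then 0 else 1) := by
  unfold mism
  simp_rw [Finset.card_filter]
  push_cast
  rw [← Finset.add_sum_erase _ _ (Finset.mem_univ i), ← Finset.add_sum_erase _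
    (fun j => if σ j ≠ τ j then (1 : ℤ) else 0) (Finset.mem_univ i)]
  rw [Finset.sum_congr rfl (g := fun j => if σ j ≠ τ j then (1 : ℤ) else 0)]
  · simp; ring
  · intro j hj
    rw [Function.update_of_ne (Finset.ne_of_mem_erase hj),
      Function.update_of_ne (Finset.ne_of_mem_erase hj)]

theorem rowDist_update_lt {n : ℕ} {ρ Y : Type*} (r : Fin n → ρ) (σ τ : Fin n → Y) {i i₀ : Fin n}
    (hi : σ i = τ i) (hi₀ : σ i₀ ≠ τ i₀) (hr : r i = r i₀) :
    rowDist r (Function.update σ i (τ i₀)) (Function.update τ i (σ i₀)) < mism σ τ := by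
  have hne : i₀ ≠ i := by rintro rfl; exact hi₀ hi
  refine lt_of_le_of_lt (rowDist_le r _ _ (Equiv.swap i i₀) ?_) ?_
  · intro k
    rcases eq_or_ne k i with rfl | hki
    · simp [hr]
    rcases eq_or_ne k i₀ with rfl | hki'
    · simp [hr]
    rw [Equiv.swap_apply_of_ne_of_ne hki hki']
  · unfold mism
    apply Finset.card_lt_card
    rw [Finset.ssubset_iff_of_subset]
    · refine ⟨i₀, by simpa using hi₀, ?_⟩
      simp [hne]
    · intro k hk
      simp only [Finset.mem_filter, Finset.mem_univ, true_and, Function.comp] at hk ⊢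
      rcases eq_or_ne k i with rfl | hki
      · simp [hne] at hk
      rcases eq_or_ne k i₀ with rfl | hki'
      · exact hi₀
      rwa [Equiv.swap_apply_of_ne_of_ne hki hki', Function.update_of_ne hki,
        Function.update_of_ne hki] at hk

end Site

section Coupling

variable (G : Type) [Group G] [Fintype G]

/-- Coupling of the factors used at a single site: `c` bounds the change of the distance. -/
theorem exists_site_coupling {n : ℕ} {ρ : Type*} (r : Fin n → ρ) (σ τ : Config G n)
    {i₀ : Fin n} (hi₀ : σ i₀ ≠ τ i₀) {δ : ℝ}
    (hσ : ∀ c, |excess G σ c| ≤ δ) (hτ : ∀ c, |excess G τ c| ≤ δ) (i : Fin n) :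
    ∃ (θ : Equiv.Perm ({j : Fin n // i ≠ j} × Bool)) (c : {j : Fin n // i ≠ j} × Bool → ℤ),
      (∀ z, c z = -1 ∨ c z = 0 ∨ c z = 1) ∧
      (∀ z, (rowDist r (Function.update σ i (σ i * factor G σ z.1.1 z.2))
        (Function.update τ i (τ i * factor G τ (θ z).1.1 (θ z).2)) : ℤ) ≤ mism σ τ + c z) ∧
      ((∑ z, c z : ℤ) : ℝ) ≤ (if σ i = τ i then 2 * (mism σ τ : ℝ) else
        Fintype.card G * (4 * δ + 2) - (2 * (n - 1 : ℕ) : ℕ)) ∧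
      (σ i = τ i → r i = r i₀ → 2 * n / Fintype.card G - 2 * δ - 2 - 2 * mism σ τ ≤
        ((Finset.univ.filter (fun z => c z = -1)).card : ℝ)) := by
  have hle : ∀ u v, (rowDist r (Function.update σ i u) (Function.update τ i v) : ℤ) ≤
      mism σ τ + (if u = v then 0 else 1) - (if σ i = τ i then 0 else 1) := by
    intro u v
    rw [← mism_update]
    exact Int.ofNat_le.2 (rowDist_le r _ (Function.update τ i v) 1 (fun _ => rfl))
  let U := Finset.univ.filter (fun i => σ i ≠ τ i)
  have hUc : U.card = mism σ τ := rfl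
  have hU : ∀ j, j ∉ U → σ j = τ j := fun j hj => by simpa [U] using hj
  by_cases hi : σ i = τ i
  swap
  · obtain ⟨θ, hθ⟩ := exists_perm_mism_le G σ τ i hσ hτ
    refine ⟨θ, fun z => if σ i * factor G σ z.1.1 z.2 = τ i * factor G τ (θ z).1.1 (θ z).2
      then -1 else 0, fun z => ?_, fun z => ?_, ?_, fun h => absurd h hi⟩
    · dsimp only; split_ifs <;> simp
    · refine (hle _ _).trans ?_
      rw [if_neg hi]
      dsimp only
      split_ifs <;> simp
    · rw [if_neg hi]
      have h1 : ∑ z, (if σ i * factor G σ z.1.1 z.2 = τ i * factor G τ (θ z).1.1 (θ z).2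
          then (-1 : ℤ) else 0) = (mism (fun z => σ i * factor G σ z.1.1 z.2)
        ((fun z : {j : Fin n // i ≠ j} × Bool => τ i * factor G τ z.1.1 z.2) ∘ θ) : ℤ) -
          (2 * (n - 1 : ℕ) : ℕ) := by
        rw [← card_partner i]
        unfold mism
        rw [Finset.card_filter, ← Finset.card_univ, Finset.card_eq_sum_ones]
        push_cast
        rw [← Finset.sum_sub_distrib]
        refine Finset.sum_congr rfl fun z _ => ?_
        by_cases h : σ i * factor G σ z.1.1 z.2 = τ i * factor G τ (θ z).1.1 (θ z).2 <;>
          simp [h]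
      rw [h1]
      push_cast at hθ ⊢
      linarith
  have hfac : ∀ z : {j : Fin n // i ≠ j} × Bool, z.1.1 ∉ U →
      τ i * factor G τ z.1.1 z.2 = σ i * factor G σ z.1.1 z.2 := fun z hz => by
    unfold factor
    rw [hi, hU _ hz]
  by_cases hr : r i = r i₀
  swap
  · refine ⟨1, fun z => if z.1.1 ∈ U then 1 else 0, fun z => ?_, fun z => ?_, ?_,
      fun _ h => absurd h hr⟩
    · dsimp only; split_ifs <;> simp
    · refine (hle _ _).trans ?_
      rw [if_pos hi]
      by_cases hz : z.1.1 ∈ U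
      · simp only [hz, if_true]; split_ifs <;> simp
      · rw [Equiv.Perm.one_apply, hfac z hz]
        simp [hz]
    · rw [if_pos hi]
      rw [← hUc]
      simpa using card_partner_mem_le i U
  obtain ⟨A, B, hAB, hc, hB', hA, hB⟩ := exists_balanced_factors G σ i U hi₀ hσ
  obtain ⟨θ, hθA, hθB, hθ⟩ := exists_perm_exchanging A B hAB hc
  rw [Finset.disjoint_left] at hAB
  refine ⟨θ, fun z => if z ∈ B then -1 else if z ∈ A ∨ z.1.1 ∈ U then 1 else 0,
    fun z => ?_, fun z => ?_, ?_, fun _ _ => ?_⟩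
  · dsimp only; split_ifs <;> simp
  · by_cases hzB : z ∈ B
    · have h1 := hA _ (hθB z hzB)
      rw [(hB z hzB).2, hfac _ h1.1, h1.2]
      have := rowDist_update_lt r σ τ hi hi₀ hr
      simp [hzB]
      omega
    · refine (hle _ _).trans ?_
      dsimp only
      rw [if_pos hi, if_neg hzB]
      by_cases hz : z ∈ A ∨ z.1.1 ∈ U
      · rw [if_pos hz]; split_ifs <;> simp
      · rw [if_neg hz]
        push Not at hz
        rw [hθ z hz.1 hzB, hfac z hz.2]
        simp
  · rw [if_pos hi]
    have h1 : ∑ z, (if z ∈ B then (-1 : ℤ) else if z ∈ A ∨ z.1.1 ∈ U then 1 else 0) ≤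
        ∑ z, ((if z ∈ A then 1 else 0) - (if z ∈ B then 1 else 0) +
          (if z.1.1 ∈ U then 1 else 0)) := by
      refine Finset.sum_le_sum fun z _ => ?_
      by_cases hzA : z ∈ A <;> by_cases hzB : z ∈ B <;> by_cases hzU : z.1.1 ∈ U <;>
        simp [hzA, hzB, hzU]
    rw [Finset.sum_add_distrib, Finset.sum_sub_distrib] at h1
    simp [hc] at h1
    have h2 := card_partner_mem_le i U
    have h3 : ((∑ z, (if z ∈ B then (-1 : ℤ) else if z ∈ A ∨ z.1.1 ∈ U then 1 else 0) : ℤ) : ℝ) ≤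
      ((Finset.univ.filter
        (fun z : {j : Fin n // i ≠ j} × Bool => z.1.1 ∈ U)).card : ℝ) := by
      refine le_trans (Int.cast_le.2 h1) (le_of_eq ?_)
      simp
    exact h3.trans h2
  · refine hB'.trans ?_
    norm_cast
    refine Finset.card_le_card fun z hz => ?_
    simp [hz]

/-- Permuting the sites of a move. -/
def permMove {n : ℕ} (π : Equiv.Perm (Fin n)) : Equiv.Perm (Move n) where
  toFun m := (⟨(π m.1.1.1, π m.1.1.2), fun h => m.1.2 (π.injective h)⟩, m.2)
  invFun m := (⟨(π.symm m.1.1.1, π.symm m.1.1.2), fun h => m.1.2 (π.symm.injective h)⟩, m.2)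
  left_inv m := by simp
  right_inv m := by simp

theorem applyMove_permMove_comp {n : ℕ} (σ : Config G n) (π : Equiv.Perm (Fin n)) (m : Move n) :
    applyMove G σ (permMove π m) ∘ π = applyMove G (σ ∘ π) m := by
  funext k
  by_cases hk : k = m.1.1.1
  · subst hk
    cases h : m.2 <;> simp [applyMove, permMove, h]
  · have : π k ≠ π m.1.1.1 := fun h => hk (π.injective h)
    simp [applyMove, permMove, hk, this]

theorem nCount_comp_perm {n : ℕ} (σ : Config G n) (π : Equiv.Perm (Fin n)) (c : G) :
    nCount G (σ ∘ π) c = nCount G σ c := by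
  have := cell_comp_perm (fun _ => ()) σ π (fun _ => rfl) () c
  simpa [cell, nCount] using this

/-- One coupled step of the two chains: `c` bounds the change of the distance. -/
theorem exists_move_coupling {n : ℕ} (r σ σ' : Config G n) {δ : ℝ} {a₀ : ℝ}
    (hσ : ∀ c, |excess G σ c| ≤ δ) (hσ' : ∀ c, |excess G σ' c| ≤ δ)
    (hpos : 0 < rowDist r σ σ')
    (hκ : 0 ≤ 2 * n / Fintype.card G - 2 * δ - 2 - 2 * (rowDist r σ σ' : ℝ))
    (hr : ∀ a, a₀ ≤ (nCount G r a : ℝ)) :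
    ∃ (Θ : Equiv.Perm (Move n)) (c : Move n → ℤ),
      (∀ m, c m = -1 ∨ c m = 0 ∨ c m = 1) ∧
      (∀ m, (rowDist r (applyMove G σ m) (applyMove G σ' (Θ m)) : ℤ) ≤
        rowDist r σ σ' + c m) ∧
      ((∑ m, c m : ℤ) : ℝ) ≤ (n - rowDist r σ σ') * (2 * rowDist r σ σ') +
        rowDist r σ σ' * (Fintype.card G * (4 * δ + 2) - (2 * (n - 1 : ℕ) : ℕ)) ∧
      (a₀ - rowDist r σ σ') *
        (2 * n / Fintype.card G - 2 * δ - 2 - 2 * (rowDist r σ σ' : ℝ)) ≤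
        ((Finset.univ.filter (fun m => c m = -1)).card : ℝ) := by
  obtain ⟨π, hπ, he⟩ := exists_perm_mism_eq_rowDist r σ σ'
  rw [← he] at hpos hκ ⊢
  generalize hτ' : σ' ∘ π = τ at hpos hκ he ⊢
  have hτ : ∀ c, |excess G τ c| ≤ δ := fun c => by
    rw [← hτ']
    unfold excess
    rw [nCount_comp_perm]
    exact hσ' c
  obtain ⟨i₀, hi₀⟩ := Finset.card_pos.1 hpos
  have hi₀ : σ i₀ ≠ τ i₀ := by simpa using hi₀
  choose θ c hc hd hs hB using exists_site_coupling G r σ τ hi₀ hσ hτ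
  let e := moveEquiv n
  refine ⟨((e.symm.trans (Equiv.sigmaCongrRight θ)).trans e).trans (permMove π),
    fun m => c (e.symm m).1 (e.symm m).2, fun m => hc _ _, fun m => ?_, ?_, ?_⟩
  · refine le_trans ?_ (hd (e.symm m).1 (e.symm m).2)
    norm_cast
    have h1 : ∀ f g : Config G n, rowDist r f g ≤ rowDist r f (g ∘ π) := by
      intro f g
      obtain ⟨κ, hκ, hk⟩ := exists_perm_mism_eq_rowDist r f (g ∘ π)
      rw [← hk]
      exact rowDist_le r f g (κ.trans π) (fun i => by simp [hπ, hκ])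
    refine (h1 _ _).trans (le_of_eq ?_)
    rw [Equiv.trans_apply, applyMove_permMove_comp, hτ']
    rfl
  · rw [e.symm.sum_comp (fun x => c x.1 x.2), Fintype.sum_sigma]
    push_cast at hs ⊢
    refine (Finset.sum_le_sum fun i _ => hs i).trans (le_of_eq ?_)
    have h2 : ((Finset.univ.filter (fun i => ¬ σ i = τ i)).card : ℝ) = mism σ τ := rfl
    have h3 : ((Finset.univ.filter (fun i => σ i = τ i)).card : ℝ) = n - mism σ τ := by
      rw [← h2, eq_sub_iff_add_eq]
      norm_cast
      rw [Finset.card_filter_add_card_filter_not]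
      simp
    rw [Finset.sum_ite, Finset.sum_const, Finset.sum_const, nsmul_eq_mul, nsmul_eq_mul, h2, h3]
  · let P := Finset.univ.filter (fun i => r i = r i₀ ∧ σ i = τ i)
    have hP : a₀ - mism σ τ ≤ (P.card : ℝ) := by
      have h4 : nCount G r (r i₀) ≤ P.card + mism σ τ := by
        unfold nCount mism
        refine le_trans (Finset.card_le_card ?_) (Finset.card_union_le _ _)
        intro i hi
        simp [P] at hi ⊢
        tauto
      have h5 : (nCount G r (r i₀) : ℝ) ≤ P.card + mism σ τ := by exact_mod_cast h4
      linarith [hr (r i₀)]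
    refine (mul_le_mul_of_nonneg_right hP hκ).trans ?_
    have h6 : (Finset.univ.filter (fun m => c (e.symm m).1 (e.symm m).2 = -1)).card =
        ∑ i, (Finset.univ.filter (fun z => c i z = -1)).card := by
      simp_rw [Finset.card_filter]
      rw [e.symm.sum_comp (fun x => if c x.1 x.2 = -1 then 1 else 0), Fintype.sum_sigma]
    rw [h6, ← nsmul_eq_mul]
    push_cast
    refine (Finset.card_nsmul_le_sum P (fun i =>
      ((Finset.univ.filter (fun z => c i z = -1)).card : ℝ)) _ fun i hi => ?_).trans
      (Finset.sum_le_sum_of_subset_of_nonneg (Finset.subset_univ _) fun _ _ _ => by positivity)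
    simp [P] at hi
    exact hB i hi.2 hi.1

end Coupling

section Potential

variable (G : Type) [Group G] [Fintype G]

theorem le_pow_of_le_add {l : ℝ} (h0 : 0 ≤ l) (h1 : l < 1) {d d' : ℕ} {c : ℤ}
    (hc : c = -1 ∨ c = 0 ∨ c = 1) (h : (d' : ℤ) ≤ d + c) :
    (1 - l) ^ d * (1 - l * c + l ^ 2 * (if c = -1 then 1 else 0)) ≤ (1 - l) ^ d' := by
  have hq0 : 0 ≤ 1 - l := by linarith
  have hq1 : 1 - l ≤ 1 := by linarith
  rcases hc with rfl | rfl | rfl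
  · obtain ⟨e, rfl⟩ : ∃ e, d = e + 1 := ⟨d - 1, by omega⟩
    refine le_trans ?_ (pow_le_pow_of_le_one hq0 hq1 (show d' ≤ e by omega))
    have : 0 ≤ (1 - l) ^ e * l ^ 3 := by positivity
    rw [pow_succ]
    push_cast
    linear_combination this
  · refine le_trans (le_of_eq ?_) (pow_le_pow_of_le_one hq0 hq1 (show d' ≤ d by omega))
    simp
  · refine le_trans (le_of_eq ?_) (pow_le_pow_of_le_one hq0 hq1 (show d' ≤ d + 1 by omega))
    simp [pow_succ]

theorem mul_lt_half_of_lt_pow {l : ℝ} (h0 : 0 ≤ l) (h1 : l < 1) {d : ℕ}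
    (h : 2 / 3 < (1 - l) ^ d) : l * d < 1 / 2 := by
  have hb := one_add_mul_le_pow (show -2 ≤ l by linarith) d
  have hp : (1 - l) ^ d * (1 + l) ^ d ≤ 1 := by
    rw [← mul_pow]
    exact pow_le_one₀ (by nlinarith) (by nlinarith)
  have h2 : 0 ≤ (d : ℝ) * l := by positivity
  nlinarith

theorem abs_excess_le {n : ℕ} {σ : Config G n} {δ : ℝ} (hδ : 0 ≤ δ) (h : spread G σ ≤ δ ^ 2)
    (c : G) : |excess G σ c| ≤ δ :=
  abs_le_of_sq_le_sq (le_trans (Finset.single_le_sum (f := fun c => excess G σ c ^ 2)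
    (fun _ _ => sq_nonneg _) (Finset.mem_univ c)) h) hδ

theorem le_gain {n β δ l Q D w S B P : ℝ} (hn : 2 ≤ n) (hβ : 0 < β) (hD1 : 1 ≤ D) (hwQ : w * Q = n)
    (hn1 : 2 * Q * β ≤ n - 2) (hδ2 : 4 * β * Q * δ ≤ n) (hl0 : 0 < l)
    (hl : l ^ 2 * (β * n) = 4 * Q ^ 2) (hlD : l * D < 1 / 2) (hP : 2 / 3 < P)
    (hS : S ≤ (n - D) * (2 * D) + D * (Q * (4 * δ + 2) - 2 * (n - 1)))
    (hB : 3 / 4 * w * (8 / 5 * w) ≤ B) :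
    n * (2 * (n - 1)) * (P + 1 / (β * n)) ≤
      P * (n * (2 * (n - 1)) - l * S + l ^ 2 * B) := by
  have hs' : β * S ≤ D * (2 * (n - 1)) := by
    have h1 : S ≤ D * (Q * (4 * δ + 2)) := by
      linarith [mul_nonneg (show 0 ≤ D by linarith) (sub_nonneg.2 hD1)]
    have h2 : β * (Q * (4 * δ + 2)) ≤ 2 * (n - 1) := by linarith
    linarith [mul_le_mul_of_nonneg_left h1 hβ.le,
      mul_le_mul_of_nonneg_left h2 (show 0 ≤ D by linarith)]
  have hB' : n * (n - 1) ≤ Q ^ 2 * B := by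
    have h2 : n ^ 2 = Q ^ 2 * w ^ 2 := by rw [← hwQ]; ring
    linarith [mul_le_mul_of_nonneg_left hB (sq_nonneg Q), sq_nonneg n]
  have hgain : 3 / 2 * (2 * (n - 1)) ≤ β * (-(l * S) + l ^ 2 * B) := by
    have h1 : β * (l * S) ≤ n - 1 := by
      linarith [mul_le_mul_of_nonneg_left hs' hl0.le,
        mul_le_mul_of_nonneg_right hlD.le (show 0 ≤ 2 * (n - 1) by linarith)]
    have h2 : 4 * (n - 1) ≤ β * (l ^ 2 * B) := by
      have h4 : n * (β * (l ^ 2 * B)) = 4 * (Q ^ 2 * B) := by linear_combination B * hl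
      refine le_of_mul_le_mul_left ?_ (show 0 < n by linarith)
      rw [h4]
      linarith
    linarith
  have hfin : n * (2 * (n - 1)) * (1 / (β * n)) ≤ P * (-(l * S) + l ^ 2 * B) := by
    have h1 : n * (2 * (n - 1)) * (1 / (β * n)) = 2 * (n - 1) / β := by
      field_simp
    rw [h1, div_le_iff₀ hβ]
    have h2 : 0 ≤ β * (-(l * S) + l ^ 2 * B) := by linarith
    linarith [mul_le_mul_of_nonneg_right hP.le h2]
  linarith

/-- Near equilibrium some coupling of the moves increases `(1 - l) ^ rowDist` on average. -/
theorem exists_perm_gain {n : ℕ} {r σ σ' : Config G n} {β δ l Q : ℝ}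
    (hQ : Q = Fintype.card G) (hn2 : 2 ≤ n) (hβ : 0 < β) (hn1 : 2 * Q * β ≤ n - 2)
    (hnβ : 25 * β ≤ n) (hnQ : 20 * Q ≤ n) (hδ0 : 0 ≤ δ) (hδ1 : 10 * Q * δ ≤ n)
    (hδ2 : 4 * β * Q * δ ≤ n) (hσ : spread G σ ≤ δ ^ 2) (hσ' : spread G σ' ≤ δ ^ 2)
    (hpos : 0 < rowDist r σ σ') (hl0 : 0 < l) (hl1 : l < 1) (hl : l ^ 2 * (β * n) = 4 * Q ^ 2)
    (hD : 2 / 3 < (1 - l) ^ rowDist r σ σ')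
    (hr : ∀ a, 4 / 5 * (n / Q) ≤ (nCount G r a : ℝ)) :
    ∃ Θ : Equiv.Perm (Move n),
      (Fintype.card (Move n) : ℝ) * ((1 - l) ^ rowDist r σ σ' + 1 / (β * n)) ≤
        ∑ m, (1 - l) ^ rowDist r (applyMove G σ m) (applyMove G σ' (Θ m)) := by
  have hQ1 : 1 ≤ Q := by rw [hQ]; exact_mod_cast Fintype.card_pos
  have hn : (2 : ℝ) ≤ n := by exact_mod_cast hn2
  have hlD := mul_lt_half_of_lt_pow hl0.le hl1 hD
  have hD1 : (1 : ℝ) ≤ rowDist r σ σ' := by exact_mod_cast hpos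
  have hln : 10 * Q ≤ l * n := by
    refine (pow_le_pow_iff_left₀ (by positivity) (by positivity) two_ne_zero).1 ?_
    nlinarith [mul_le_mul_of_nonneg_left hnβ (show 0 ≤ l ^ 2 * n by positivity)]
  set w : ℝ := n / Q with hw
  have hwQ : w * Q = n := by rw [hw]; field_simp
  have hw20 : 20 ≤ w := by rw [hw, le_div_iff₀ (by positivity)]; exact hnQ
  have hδw : 10 * δ ≤ w := by rw [hw, le_div_iff₀ (by positivity)]; linarith
  have hDw : 20 * (rowDist r σ σ' : ℝ) ≤ w := by
    rw [hw, le_div_iff₀ (by positivity)]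
    nlinarith
  have h2w : 2 * (n : ℝ) / Fintype.card G = 2 * w := by rw [← hQ, hw]; ring
  have hκ : 8 / 5 * w ≤ 2 * n / Fintype.card G - 2 * δ - 2 - 2 * (rowDist r σ σ' : ℝ) := by
    rw [h2w]; linarith
  obtain ⟨Θ, c, hc, hd, hs, hB⟩ := exists_move_coupling G r σ σ' (abs_excess_le G hδ0 hσ)
    (abs_excess_le G hδ0 hσ') hpos (le_trans (by positivity) hκ) hr
  refine ⟨Θ, ?_⟩
  have hN : (Fintype.card (Move n) : ℝ) = n * (2 * (n - 1)) := by
    rw [card_move]; push_cast [Nat.cast_sub (show 1 ≤ n by omega)]; ring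
  have hsum : ∑ m, (1 - l) ^ rowDist r σ σ' * (1 - l * c m + l ^ 2 *
      (if c m = -1 then 1 else 0)) ≤
      ∑ m, (1 - l) ^ rowDist r (applyMove G σ m) (applyMove G σ' (Θ m)) :=
    Finset.sum_le_sum fun m _ => le_pow_of_le_add hl0.le hl1 (hc m) (hd m)
  refine le_trans ?_ hsum
  rw [← Finset.mul_sum, Finset.sum_add_distrib, Finset.sum_sub_distrib, ← Finset.mul_sum,
    ← Finset.mul_sum, ← Int.cast_sum, Finset.sum_boole]
  simp only [Finset.sum_const, Finset.card_univ, nsmul_eq_mul, mul_one]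
  rw [hN]
  refine le_gain hn hβ hD1 hwQ hn1 hδ2 hl0 hl hlD hD (hs.trans (le_of_eq ?_))
    (le_trans (mul_le_mul (by linarith) hκ (by positivity) (by linarith)) hB)
  push_cast [Nat.cast_sub (show 1 ≤ n by omega)]
  rw [← hQ]

/-- The function dominating the probability that coalescence fails in `k` further steps. -/
def potential {n : ℕ} (r : Config G n) (l δ T : ℝ) (k : ℕ) (p : Config G n × Config G n) : ℝ :=
  min 1 (1 - k / T + 3 * (1 - (1 - l) ^ rowDist r p.1 p.2) +
    (spread G p.1 + spread G p.2 + 12 * k) / δ ^ 2)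

theorem exists_perm_potential_step {n : ℕ} {r : Config G n} {β δ l Q T : ℝ}
    (hQ : Q = Fintype.card G) (hn2 : 2 ≤ n) (hβ : 0 < β) (hn1 : 2 * Q * β ≤ n - 2)
    (hnβ : 25 * β ≤ n) (hnQ : 20 * Q ≤ n) (hδ0 : 0 < δ) (hδ1 : 10 * Q * δ ≤ n)
    (hδ2 : 4 * β * Q * δ ≤ n) (hl0 : 0 < l) (hl1 : l < 1)
    (hl : l ^ 2 * (β * n) = 4 * Q ^ 2) (hT : β * n ≤ 3 * T)
    (hr : ∀ a, 4 / 5 * (n / Q) ≤ (nCount G r a : ℝ))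
    (p : Config G n × Config G n) (hpos : 0 < rowDist r p.1 p.2) :
    ∃ Θ : Equiv.Perm (Move n), ∀ k : ℕ, (k + 1 : ℝ) ≤ T →
      ∑ m, potential G r l δ T k (applyMove G p.1 m, applyMove G p.2 (Θ m)) ≤
        (Fintype.card (Move n) : ℝ) * potential G r l δ T (k + 1) p := by
  have hn : (2 : ℝ) ≤ n := by exact_mod_cast hn2
  have hT0 : 0 < T := by
    have : 0 < β * n := by positivity
    linarith
  have hone : ∀ (Θ : Equiv.Perm (Move n)) (k : ℕ),
      ∑ m, potential G r l δ T k (applyMove G p.1 m, applyMove G p.2 (Θ m)) ≤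
        (Fintype.card (Move n) : ℝ) * 1 := fun Θ k => by
    refine (Finset.sum_le_card_nsmul _ _ 1 fun m _ => min_le_left _ _).trans ?_
    rw [nsmul_eq_mul, Finset.card_univ]
  have hs1 := spread_nonneg G p.1
  have hs2 := spread_nonneg G p.2
  have hP1 : (1 - l) ^ rowDist r p.1 p.2 ≤ 1 := pow_le_one₀ (by linarith) (by linarith)
  have hfrac : ∀ k : ℕ, (k + 1 : ℝ) ≤ T → 0 ≤ 1 - ((k + 1 : ℕ) : ℝ) / T := fun k hk => by
    rw [sub_nonneg, div_le_one hT0]; exact_mod_cast hk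
  by_cases hgood : 2 / 3 < (1 - l) ^ rowDist r p.1 p.2 ∧
    spread G p.1 + spread G p.2 ≤ δ ^ 2
  · obtain ⟨Θ, hΘ⟩ := exists_perm_gain G hQ hn2 hβ hn1 hnβ hnQ hδ0.le hδ1 hδ2 (by linarith)
      (by linarith) hpos hl0 hl1 hl hgood.1 hr
    refine ⟨Θ, fun k hk => ?_⟩
    rw [potential, mul_min_of_nonneg _ _ (Nat.cast_nonneg _)]
    refine le_min (hone Θ k) ?_
    refine (Finset.sum_le_sum fun m _ => min_le_right _ _).trans ?_
    have h1 := sum_spread_applyMove_le G hn2 p.1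
    have h2 := sum_spread_applyMove_le G hn2 p.2
    rw [← Equiv.sum_comp Θ] at h2
    rw [Finset.sum_add_distrib, Finset.sum_add_distrib, ← Finset.sum_div, ← Finset.mul_sum,
      Finset.sum_add_distrib, Finset.sum_add_distrib, Finset.sum_sub_distrib,
      Finset.sum_sub_distrib]
    simp only [Finset.sum_const, Finset.card_univ, nsmul_eq_mul]
    set N : ℝ := (Fintype.card (Move n) : ℝ)
    have hN0 : 0 ≤ N := Nat.cast_nonneg _
    have h3 : (∑ m, spread G (applyMove G p.1 m) + ∑ m, spread G (applyMove G p.2 (Θ m)) +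
        N * (12 * k)) / δ ^ 2 ≤
        N * ((spread G p.1 + spread G p.2 + 12 * ((k + 1 : ℕ) : ℝ)) / δ ^ 2) := by
      rw [← mul_div_assoc]
      refine div_le_div_of_nonneg_right ?_ (by positivity)
      push_cast
      linarith
    have h4 : N * (1 / T) ≤ 3 * (N * (1 / (β * n))) := by
      have : 1 / T ≤ 3 * (1 / (β * n)) := by
        rw [div_le_iff₀ hT0]
        have : 0 < β * n := by positivity
        field_simp
        linarith
      nlinarith
    have h5 : N * (1 - ((k + 1 : ℕ) : ℝ) / T) = N * (1 - k / T) - N * (1 / T) := by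
      push_cast; ring
    rw [mul_add] at hΘ
    rw [mul_add, mul_add, h5]
    linarith
  · refine ⟨1, fun k hk => (hone 1 k).trans ?_⟩
    refine mul_le_mul_of_nonneg_left (le_min le_rfl ?_) (Nat.cast_nonneg _)
    have h1 := hfrac k hk
    by_cases hD : 2 / 3 < (1 - l) ^ rowDist r p.1 p.2
    · have h2 : δ ^ 2 < spread G p.1 + spread G p.2 := by
        by_contra h; exact hgood ⟨hD, not_lt.1 h⟩
      have h3 : 1 ≤ (spread G p.1 + spread G p.2 + 12 * ((k + 1 : ℕ) : ℝ)) / δ ^ 2 := by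
        rw [le_div_iff₀ (by positivity)]
        have : (0 : ℝ) ≤ ((k + 1 : ℕ) : ℝ) := by positivity
        linarith
      linarith
    · have h3 : 0 ≤ (spread G p.1 + spread G p.2 + 12 * ((k + 1 : ℕ) : ℝ)) / δ ^ 2 := by
        positivity
      linarith

end Potential

section Main

variable (G : Type) [Group G] [Fintype G]

theorem abs_le_of_sqrt_sum_sq_le {ι : Type*} [Fintype ι] {f : ι → ℝ} {x : ℝ}
    (h : Real.sqrt (∑ i, f i ^ 2) ≤ x) (i : ι) : |f i| ≤ x :=
  (Real.abs_le_sqrt (Finset.single_le_sum (f := fun i => f i ^ 2) (fun _ _ => sq_nonneg _)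
    (Finset.mem_univ i))).trans h

theorem le_nCount_of_mem_SAst {n : ℕ} (hn : 0 < n) {r : Config G n}
    (hr : r ∈ SAst G n (1 / (5 * (Fintype.card G : ℝ) ^ 3))) (a : G) :
    4 / 5 * (n / (Fintype.card G : ℝ)) ≤ (nCount G r a : ℝ) := by
  have h := abs_le_of_sqrt_sum_sq_le hr.2 a
  have hQ : (1 : ℝ) ≤ Fintype.card G := by exact_mod_cast Fintype.card_pos
  set Q : ℝ := (Fintype.card G : ℝ)
  have hn' : (0 : ℝ) < n := by exact_mod_cast hn
  have h1 : 1 / (5 * Q ^ 3) ≤ 1 / 5 * (1 / Q) := by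
    rw [← one_div_mul_one_div]
    refine mul_le_mul_of_nonneg_left ?_ (by norm_num)
    exact one_div_le_one_div_of_le (by positivity) (le_self_pow₀ hQ (by norm_num))
  have h2 : 4 / 5 * (1 / Q) ≤ (nCount G r a : ℝ) / n := by
    have := (abs_le.1 h).1
    linarith
  rw [le_div_iff₀ hn'] at h2
  calc 4 / 5 * (n / Q) = 4 / 5 * (1 / Q) * n := by ring
    _ ≤ _ := h2

theorem abs_nab_sub_le {n : ℕ} {r σ : Config G n} {ρ : ℝ} (h : σ ∈ SAstM G r ρ) (a b : G) :
    |(nab G r σ a b : ℝ) - nCount G r a / Fintype.card G| ≤ nCount G r a * ρ := by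
  rcases Nat.eq_zero_or_pos (nCount G r a) with h0 | h0
  · have : nab G r σ a b = 0 := by
      have : nab G r σ a b ≤ nCount G r a :=
        Finset.card_le_card fun i hi => by
          simp only [Finset.mem_filter] at hi ⊢
          exact ⟨hi.1, hi.2.1⟩
      omega
    simp [this, h0]
  · have h0' : (0 : ℝ) < nCount G r a := by exact_mod_cast h0
    have h1 := mul_le_mul_of_nonneg_left (abs_le_of_sqrt_sum_sq_le (h.2 a) b) h0'.le
    refine le_trans (le_of_eq ?_) h1
    rw [← abs_of_pos h0', ← abs_mul, abs_of_pos h0']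
    congr 1
    field_simp

theorem sum_nab {n : ℕ} (r σ : Config G n) (b : G) : ∑ a, nab G r σ a b = nCount G σ b := by
  rw [nCount, Finset.card_eq_sum_card_fiberwise (f := r) (t := Finset.univ) (by simp)]
  refine Finset.sum_congr rfl fun a _ => ?_
  rw [nab, Finset.filter_filter]
  simp only [and_comm]

theorem sum_nCount {n : ℕ} (r : Config G n) : ∑ a, nCount G r a = n := by
  simpa [nCount] using (Finset.card_eq_sum_card_fiberwise (s := Finset.univ) (f := r)
    (t := Finset.univ) (by simp)).symm

theorem sum_nCount_cast {n : ℕ} (r : Config G n) : ∑ a, (nCount G r a : ℝ) = n := by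
  exact_mod_cast sum_nCount G r

theorem spread_le_of_mem_SAstM {n : ℕ} {r σ : Config G n} {ρ : ℝ} (h : σ ∈ SAstM G r ρ) :
    spread G σ ≤ Fintype.card G * (n * ρ) ^ 2 := by
  have key : ∀ c, |excess G σ c| ≤ n * ρ := fun c => by
    have h1 : excess G σ c = ∑ a, ((nab G r σ a c : ℝ) - nCount G r a / Fintype.card G) := by
      rw [Finset.sum_sub_distrib, ← Finset.sum_div, sum_nCount_cast, excess, ← sum_nab G r σ c]
      push_cast
      rfl
    rw [h1]
    calc _ ≤ ∑ a, |(nab G r σ a c : ℝ) - nCount G r a / Fintype.card G| :=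
          Finset.abs_sum_le_sum_abs _ _
      _ ≤ ∑ a, nCount G r a * ρ := Finset.sum_le_sum fun a _ => abs_nab_sub_le G h a c
      _ = n * ρ := by rw [← Finset.sum_mul, sum_nCount_cast]
  calc spread G σ ≤ ∑ _c : G, (n * ρ) ^ 2 := Finset.sum_le_sum fun c _ => by
        rw [← sq_abs]; exact pow_le_pow_left₀ (abs_nonneg _) (key c) 2
    _ = _ := by simp

theorem rowDist_le_of_mem_SAstM {n : ℕ} {r σ σ' : Config G n} {ρ : ℝ} (h : σ ∈ SAstM G r ρ)
    (h' : σ' ∈ SAstM G r ρ) : (rowDist r σ σ' : ℝ) ≤ 2 * Fintype.card G * (n * ρ) := by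
  refine (rowDist_le_sum r σ σ').trans ?_
  calc _ ≤ ∑ a : G, ∑ _b : G, 2 * (nCount G r a * ρ) :=
        Finset.sum_le_sum fun a _ => Finset.sum_le_sum fun b _ => by
          have h1 := abs_le.1 (abs_nab_sub_le G h a b)
          have h2 := abs_le.1 (abs_nab_sub_le G h' a b)
          change |(nab G r σ a b : ℝ) - nab G r σ' a b| ≤ _
          rw [abs_le]
          constructor <;> linarith [h1.1, h1.2, h2.1, h2.2]
    _ = ∑ a : G, (nCount G r a : ℝ) * (2 * Fintype.card G * ρ) := by
        refine Finset.sum_congr rfl fun a _ => ?_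
        rw [Finset.sum_const, Finset.card_univ, nsmul_eq_mul]
        ring
    _ = _ := by rw [← Finset.sum_mul, sum_nCount_cast]; ring

theorem potential_le {n : ℕ} {r : Config G n} {l δ T : ℝ} (hl1 : l ≤ 1)
    {k : ℕ} (hk : (k : ℝ) = T) (hT : 0 < T) (p : Config G n × Config G n) :
    potential G r l δ T k p ≤ 3 * (l * rowDist r p.1 p.2) +
      (spread G p.1 + spread G p.2 + 12 * T) / δ ^ 2 := by
  refine (min_le_right _ _).trans ?_
  have h := one_add_mul_le_pow (show -2 ≤ -l by linarith) (rowDist r p.1 p.2)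
  rw [← sub_eq_add_neg 1 l] at h
  rw [hk, div_self hT.ne']
  linarith

theorem exists_coupling_jointPathProb_le {n : ℕ} {r : Config G n} {β δ l Q : ℝ} {T : ℕ}
    (hQ : Q = Fintype.card G) (hn2 : 2 ≤ n) (hβ : 0 < β) (hn1 : 2 * Q * β ≤ n - 2)
    (hnβ : 25 * β ≤ n) (hnQ : 20 * Q ≤ n) (hδ0 : 0 < δ) (hδ1 : 10 * Q * δ ≤ n)
    (hδ2 : 4 * β * Q * δ ≤ n) (hl0 : 0 < l) (hl1 : l < 1)
    (hl : l ^ 2 * (β * n) = 4 * Q ^ 2) (hT : β * n ≤ 3 * T)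
    (hr : ∀ a, 4 / 5 * (n / Q) ≤ (nCount G r a : ℝ)) (start : Config G n × Config G n) :
    ∃ K, IsCouplingKernel G K ∧
      jointPathProb G K start T {p | ∀ t, ∃ a b : G, nab G r (p t).1 a b ≠ nab G r (p t).2 a b}
        ≤ potential G r l δ T T start := by
  have hstep : ∀ p : Config G n × Config G n, ∃ Θ : Equiv.Perm (Move n),
      0 < rowDist r p.1 p.2 → ∀ k : ℕ, (k + 1 : ℝ) ≤ T →
      ∑ m, potential G r l δ T k (applyMove G p.1 m, applyMove G p.2 (Θ m)) ≤
        (Fintype.card (Move n) : ℝ) * potential G r l δ T (k + 1) p := fun p => by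
    by_cases h : 0 < rowDist r p.1 p.2
    · obtain ⟨Θ, hΘ⟩ := exists_perm_potential_step G hQ hn2 hβ hn1 hnβ hnQ hδ0 hδ1 hδ2 hl0 hl1
        hl hT hr p h
      exact ⟨Θ, fun _ => hΘ⟩
    · exact ⟨1, fun h' => absurd h' h⟩
  choose Θ hΘ using hstep
  have hK := permKernel_isCouplingKernel G Θ
  refine ⟨permKernel G Θ, hK, ?_⟩
  have hn : (2 : ℝ) ≤ n := by exact_mod_cast hn2
  have hT0 : (0 : ℝ) < T := by
    have : 0 < β * n := by positivity
    linarith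
  have hrest : ∀ (k : ℕ) (p : Config G n × Config G n),
      0 ≤ 3 * (1 - (1 - l) ^ rowDist r p.1 p.2) +
        (spread G p.1 + spread G p.2 + 12 * k) / δ ^ 2 := fun k p => by
    have h1 : (1 - l) ^ rowDist r p.1 p.2 ≤ 1 := pow_le_one₀ (by linarith) (by linarith)
    have h2 := spread_nonneg G p.1
    have h3 := spread_nonneg G p.2
    have h4 : 0 ≤ (spread G p.1 + spread G p.2 + 12 * k) / δ ^ 2 := by positivity
    linarith
  have hNpos : (0 : ℝ) < Fintype.card (Move n) := by
    rw [card_move]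
    have : 0 < n * (2 * (n - 1)) := Nat.mul_pos (by omega) (by omega)
    exact_mod_cast this
  refine jointPathProb_le G hK.1
    {p | ∃ a b : G, nab G r p.1 a b ≠ nab G r p.2 a b} (fun k => potential G r l δ T k) T
    (fun k hk p => ?_) (fun p _ => ?_) (fun k hk p hp => ?_) start
  · have h1 : 0 ≤ 1 - (k : ℝ) / T := by
      rw [sub_nonneg, div_le_one hT0]; exact_mod_cast hk
    refine le_min zero_le_one ?_
    linarith [hrest k p]
  · refine le_min le_rfl ?_
    have := hrest 0 p
    simp only [Nat.cast_zero, zero_div] at this ⊢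
    linarith
  · have hp' : 0 < rowDist r p.1 p.2 := by
      refine Nat.pos_of_ne_zero fun h => ?_
      obtain ⟨a, b, hab⟩ := hp
      exact hab (cell_eq_of_rowDist_eq_zero r p.1 p.2 h a b)
    rw [sum_permKernel_mul, div_le_iff₀ hNpos, mul_comm]
    exact hΘ p hp' k (by exact_mod_cast hk)

end Main

end PR

/-- Lemma 2.5: let `σ_* ∈ S_*(1/(5Q³))` and `R > 0`, and let
`σ, σt ∈ S_*(σ_*, R/√n)`.  Then there is a coupling of the two product replacement chains
started at `(σ, σt)` such that for any given `β > 0` and all large enough `n`,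
`Pr(τ > βn) ≤ 32 Q² R / √β`, where `τ` is the first time the two proportion matrices
(w.r.t. `σ_*`) agree. -/
theorem coupling_coalescence
    (G : Type) [Group G] [Fintype G] :
    ∀ R : ℝ, 0 < R → ∀ β : ℝ, 0 < β →
      ∃ N : ℕ, ∀ n : ℕ, N ≤ n →
        ∀ σast ∈ PR.SAst G n (1 / (5 * (Fintype.card G : ℝ) ^ 3)),
        ∀ σ ∈ PR.SAstM G σast (R / Real.sqrt n),
        ∀ σt ∈ PR.SAstM G σast (R / Real.sqrt n),
          ∃ K, PR.IsCouplingKernel G K ∧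
            PR.jointPathProb G K (σ, σt) ⌊β * n⌋₊
              {p | ∀ t, ∃ a b : G,
                PR.nab G σast (p t).1 a b ≠ PR.nab G σast (p t).2 a b}
            ≤ 32 * (Fintype.card G : ℝ) ^ 2 * R / Real.sqrt β := by
  intro R hR β hβ
  have hQ1 : (1 : ℝ) ≤ Fintype.card G := by exact_mod_cast Fintype.card_pos
  obtain ⟨Q, hQ⟩ : ∃ Q : ℝ, Q = Fintype.card G := ⟨_, rfl⟩
  rw [← hQ] at hQ1 ⊢
  have hQ0 : 0 < Q := by linarith
  have hsβ : 0 < Real.sqrt β := Real.sqrt_pos.2 hβ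
  obtain ⟨η, hη0, hη1, hη2⟩ : ∃ η : ℝ, 0 < η ∧ 10 * Q * η ≤ 1 ∧ 4 * β * Q * η ≤ 1 := by
    refine ⟨min (1 / (10 * Q)) (1 / (4 * β * Q)), lt_min (by positivity) (by positivity), ?_, ?_⟩
    · rw [mul_comm, ← le_div_iff₀ (by positivity)]
      exact min_le_left _ _
    · rw [mul_comm, ← le_div_iff₀ (by positivity)]
      exact min_le_right _ _
  set c : ℝ := η ^ 2 * (20 * Q ^ 2 * R / Real.sqrt β) with hc
  have hc0 : 0 < c := by positivity
  set M : ℝ := 2 * Q * R ^ 2 + 12 * β with hM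
  have hM0 : 0 < M := by positivity
  obtain ⟨N, hN⟩ := exists_nat_ge (2 + 2 * Q * β + 25 * β + 20 * Q + (3 / 2 + 4 * Q ^ 2 + 1) / β
    + M / c)
  refine ⟨N, fun n hNn σast hast σ hσ σt hσt => ?_⟩
  have hn : 2 + 2 * Q * β + 25 * β + 20 * Q + (3 / 2 + 4 * Q ^ 2 + 1) / β + M / c ≤ n :=
    hN.trans (by exact_mod_cast hNn)
  have hp1 : 0 < Q * β := by positivity
  have hp2 : 0 < (3 / 2 + 4 * Q ^ 2 + 1) / β := by positivity
  have hp3 : 0 < M / c := by positivity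
  have hn2 : (2 : ℝ) ≤ n := by linarith
  have hn0 : (0 : ℝ) < n := by linarith
  have hβn : 3 / 2 + 4 * Q ^ 2 + 1 ≤ β * n := by
    rw [mul_comm β, ← div_le_iff₀ hβ]
    linarith
  have hMn : M ≤ c * n := by
    rw [mul_comm c, ← div_le_iff₀ hc0]
    linarith
  have hsn : 0 < Real.sqrt n := Real.sqrt_pos.2 hn0
  have hsn2 : Real.sqrt n * Real.sqrt n = n := Real.mul_self_sqrt hn0.le
  have hβn0 : 0 < β * n := by positivity
  have hQβ : 2 * Q < Real.sqrt (β * n) := Real.lt_sqrt_of_sq_lt (by linarith)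
  set l : ℝ := 2 * Q / Real.sqrt (β * n) with hl
  have hl0 : 0 < l := by positivity
  have hl1 : l < 1 := (div_lt_one (by positivity)).2 hQβ
  have hl2 : l ^ 2 * (β * n) = 4 * Q ^ 2 := by
    rw [hl, div_pow, Real.sq_sqrt hβn0.le]
    field_simp
    norm_num
  have hTle : (⌊β * n⌋₊ : ℝ) ≤ β * n := Nat.floor_le hβn0.le
  have hTlt := Nat.lt_floor_add_one (β * n)
  obtain ⟨K, hK, hKle⟩ := PR.exists_coupling_jointPathProb_le G (r := σast) (β := β)
    (δ := η * n) (l := l) (T := ⌊β * n⌋₊) hQ (by exact_mod_cast hn2) hβ (by linarith)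
    (by linarith) (by linarith) (by positivity)
    (by linarith [mul_le_mul_of_nonneg_right hη1 hn0.le])
    (by linarith [mul_le_mul_of_nonneg_right hη2 hn0.le]) hl0 hl1 hl2
    (by linarith [sq_nonneg Q])
    (fun a => by
      rw [hQ] at hast ⊢
      exact PR.le_nCount_of_mem_SAst G (by exact_mod_cast hn0) hast a) (σ, σt)
  refine ⟨K, hK, hKle.trans ?_⟩
  refine (PR.potential_le G hl1.le rfl (by linarith [sq_nonneg Q]) _).trans ?_
  have hD := PR.rowDist_le_of_mem_SAstM G hσ hσt
  have hs := PR.spread_le_of_mem_SAstM G hσ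
  have hs' := PR.spread_le_of_mem_SAstM G hσt
  have hρ : (n : ℝ) * (R / Real.sqrt n) = R * Real.sqrt n := by
    field_simp
    linarith
  rw [← hQ, hρ] at hD hs hs'
  rw [mul_pow, Real.sq_sqrt hn0.le] at hs hs'
  have h1 : 3 * (l * PR.rowDist σast σ σt) ≤ 12 * Q ^ 2 * R / Real.sqrt β := by
    calc 3 * (l * PR.rowDist σast σ σt) ≤ 3 * (l * (2 * Q * (R * Real.sqrt n))) := by gcongr
      _ = _ := by
        rw [hl, Real.sqrt_mul hβ.le]
        field_simp
        norm_num
  have h2 : (PR.spread G σ + PR.spread G σt + 12 * (⌊β * n⌋₊ : ℝ)) / (η * n) ^ 2 ≤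
      20 * Q ^ 2 * R / Real.sqrt β := by
    rw [div_le_iff₀ (by positivity)]
    have h3 := mul_le_mul_of_nonneg_right hMn hn0.le
    have h4 : 20 * Q ^ 2 * R / Real.sqrt β * (η * n) ^ 2 = c * n * n := by rw [hc]; ring
    rw [h4]
    refine le_trans ?_ h3
    rw [hM]
    linarith
  have h5 : 32 * Q ^ 2 * R / Real.sqrt β =
      12 * Q ^ 2 * R / Real.sqrt β + 20 * Q ^ 2 * R / Real.sqrt β := by ring
  rw [h5]
  exact add_le_add h1 h2
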